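/- Let b and c be rational numbers with D(b,c) ≠ 0 and K(b,c) ≠ 0, and suppose bc² − 4bc + 4b + 2 = 0. Then E30 = 0, so that x = 0 is a root of the first cubic polynomial P, and Q(−1) = 0, so that d = −1 is a root of the second cubic polynomial Q; in particular both P and Q are reducible over ℚ. -/

import Mathlib

noncomputable section

/-- The common denominator `D(b,c)`. -/
def Dd (b c : ℚ) : ℚ := b^2*c^2 + 2*b^2 - 3*b^2*c + c - b*c^2 + 2*b

/-- The quantity `K(b,c)`. -/
def Kk (b c : ℚ) : ℚ := b^2*c^4 - 6*b^2*c^3 + 13*b^2*c^2 - 12*b^2*c + 4*b^2 + c^2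

def E10 (b c : ℚ) : ℚ := -(b^2*c^2 + 2*b^2 - 3*b^2*c - c) / Dd b c

def E20 (b c : ℚ) : ℚ :=
  (b/2)*(b*c^2 - 2*c - 2*b)*(2*b*c^2 - c^2 - 6*b*c + 2 + 4*b) / (Dd b c)^2

def E30 (b c : ℚ) : ℚ :=
  b^2*c*(1 - c)*(c - 2)*(b*c^2 - 4*b*c + 2 + 4*b)*(2*b*c^2 - c^2 - 4*b*c + 2*b)
    / (Kk b c * (Dd b c)^2)

def E01 (b c : ℚ) : ℚ := -(b*(c^2 + 2 - 2*c)) / Dd b c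

def E02 (b c : ℚ) : ℚ :=
  (1/2)*(28*b^2*c^2 - 16*b^2*c - 2*c^2 - 4*b^2 - b^2*c^4 + 4*b^3*c^4 - 12*b^3*c^3
    + 4*b*c^3 + 24*b^3*c - 8*b*c - 2*b^4*c^4 + 12*b^4*c^3 - 26*b^4*c^2 - 8*b^2*c^3
    + 24*b^4*c - 16*b^3 - 8*b^4) / (Dd b c)^2

def E03 (b c : ℚ) : ℚ :=
  (b/2)*(b^2*c^4 - 5*b^2*c^3 + 10*b^2*c^2 - 10*b^2*c + 4*b^2 + 2*b*c + 2*c^2 - b*c^3)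
    *(2*b^2*c^4 - 12*b^2*c^3 + 26*b^2*c^2 - 24*b^2*c + 8*b^2 - b*c^4 + 3*b*c^3
      - 6*b*c + 4*b + c^3 - 2*c^2 + 2*c) / (Kk b c * (Dd b c)^2)

/-- The first cubic polynomial, evaluated at `x`. -/
def P (b c x : ℚ) : ℚ := x^3 - E10 b c * x^2 + E20 b c * x - E30 b c

/-- The second cubic polynomial, evaluated at `d`. -/
def Q (b c d : ℚ) : ℚ := d^3 - E01 b c * d^2 + E02 b c * d - E03 b c

open Polynomial in
/-- The first cubic as a polynomial over `ℚ`. -/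
def Ppoly (b c : ℚ) : Polynomial ℚ :=
  X^3 - C (E10 b c) * X^2 + C (E20 b c) * X - C (E30 b c)

open Polynomial in
/-- The second cubic as a polynomial over `ℚ`. -/
def Qpoly (b c : ℚ) : Polynomial ℚ :=
  X^3 - C (E01 b c) * X^2 + C (E02 b c) * X - C (E03 b c)

/-- The rational perfect cuboid equations with unit space diagonal. -/
def CuboidEqs (x1 x2 x3 d1 d2 d3 : ℚ) : Prop :=
  x1^2 + x2^2 + x3^2 = 1 ∧ x2^2 + x3^2 = d1^2 ∧ x3^2 + x1^2 = d2^2 ∧ x1^2 + x2^2 = d3^2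

/-- The auxiliary equations with prescribed right-hand sides `E21`, `E11`, `E12`. -/
def AuxEqs (x1 x2 x3 d1 d2 d3 E21 E11 E12 : ℚ) : Prop :=
  x1*x2*d3 + x2*x3*d1 + x3*x1*d2 = E21 ∧
  x1*d2 + d1*x2 + x2*d3 + d2*x3 + x3*d1 + d3*x1 = E11 ∧
  x1*d2*d3 + x2*d3*d1 + x3*d1*d2 = E12

/-- The numerator of `Q b c (-1)` vanishes on the curve `b(c - 2)² = -2`. -/
lemma Q_neg_one_numerator_eq_zero (b c : ℚ) (h : b*c^2 - 4*b*c + 4*b + 2 = 0) :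
    Kk b c * (Dd b c)^2 - Kk b c * Dd b c * (b*(c^2 + 2 - 2*c))
    + Kk b c * ((1/2)*(28*b^2*c^2 - 16*b^2*c - 2*c^2 - 4*b^2 - b^2*c^4 + 4*b^3*c^4
      - 12*b^3*c^3 + 4*b*c^3 + 24*b^3*c - 8*b*c - 2*b^4*c^4 + 12*b^4*c^3 - 26*b^4*c^2
      - 8*b^2*c^3 + 24*b^4*c - 16*b^3 - 8*b^4))
    + (b/2)*(b^2*c^4 - 5*b^2*c^3 + 10*b^2*c^2 - 10*b^2*c + 4*b^2 + 2*b*c + 2*c^2 - b*c^3)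
      *(2*b^2*c^4 - 12*b^2*c^3 + 26*b^2*c^2 - 24*b^2*c + 8*b^2 - b*c^4 + 3*b*c^3
        - 6*b*c + 4*b + c^3 - 2*c^2 + 2*c) = 0 := by
  have hc : c - 2 ≠ 0 := by
    intro hc
    obtain rfl : c = 2 := by linarith
    linarith
  have hb : b = -2 / (c - 2)^2 := by
    rw [eq_div_iff (pow_ne_zero 2 hc)]
    linarith
  rw [hb]
  unfold Kk Dd
  field_simp
  ring

open Polynomial in
/-- A monic cubic over a field with a root is reducible. -/
lemma not_irreducible_cubic_of_root {F : Type*} [Field F] (p q r a : F)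
    (ha : a^3 - p * a^2 + q * a - r = 0) :
    ¬ Irreducible (X^3 - C p * X^2 + C q * X - C r : F[X]) := by
  have hdeg : (X^3 - C p * X^2 + C q * X - C r : F[X]).degree = 3 := by
    compute_degree!
  intro hirr
  have h_one := degree_eq_one_of_irreducible_of_root hirr (x := a) (by simpa [IsRoot] using ha)
  rw [hdeg] at h_one
  norm_num at h_one

/-- The fifth reducibility condition `bc² − 4bc + 4b + 2 = 0`. -/
theorem stmt12 (b c : ℚ) (hD : Dd b c ≠ 0) (hK : Kk b c ≠ 0)
    (h : b*c^2 - 4*b*c + 4*b + 2 = 0) :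
    E30 b c = 0 ∧ P b c 0 = 0 ∧ Q b c (-1) = 0 ∧
    ¬ Irreducible (Ppoly b c) ∧ ¬ Irreducible (Qpoly b c) := by
  have hE : E30 b c = 0 := by
    have h' : b*c^2 - 4*b*c + 2 + 4*b = 0 := by linarith
    simp [E30, h']
  have hP : P b c 0 = 0 := by simp [P, hE]
  have hQ : Q b c (-1) = 0 := by
    rw [← neg_eq_zero]
    refine (mul_eq_zero_iff_left (mul_ne_zero hK (pow_ne_zero 2 hD))).mp ?_
    rw [← Q_neg_one_numerator_eq_zero b c h]
    unfold Q E01 E02 E03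
    field_simp
    ring
  exact ⟨hE, hP, hQ, not_irreducible_cubic_of_root _ _ _ _ hP,
    not_irreducible_cubic_of_root _ _ _ _ hQ⟩

end
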